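/- arXiv:1606.08610 — 2 statements merged into one kernel-verified Lean document; each statement's English description precedes it below -/
import Mathlib

section
/- Let n ≥ 2, s ∈ (0,1), λ ≥ 1, ε > 0, and let K ∈ 𝐊(n,s,λ,ε). Let Ω ⊆ ℝⁿ be a bounded open set with P(Ω) < ∞, let σ ∈ (−1,1), g ∈ L^∞(Ω), and m ∈ (0,|Ω|). Then the infimum γ = inf{ 𝓔(E) + ∫_E g(x) dx : E ⊆ Ω measurable, |E| = m } is attained by some measurable set E ⊆ Ω with |E| = m; moreover every such minimizer E satisfies I(E, Ω∖E) < ∞. -/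
open MeasureTheory Filter Metric
open scoped ENNReal NNReal symmDiff Topology

/-- Nonlocal interaction energy `I(E,F) = ∫_E ∫_F K(x-y) dy dx` (with values in `ℝ≥0∞`). -/
noncomputable def inter {n : ℕ} (K : EuclideanSpace ℝ (Fin n) → ℝ)
    (E F : Set (EuclideanSpace ℝ (Fin n))) : ℝ≥0∞ :=
  ∫⁻ x in E, ∫⁻ y in F, ENNReal.ofReal (K (x - y))

/-- Nonlocal capillarity energy `𝓔(E) = I(E, Ω∖E) + σ I(E, Ωᶜ)`, with values in `EReal`
(the first term may be `+∞`; the second is finite whenever `P(Ω) < ∞`). -/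
noncomputable def capEnergy {n : ℕ} (K : EuclideanSpace ℝ (Fin n) → ℝ)
    (Ω : Set (EuclideanSpace ℝ (Fin n))) (σ : ℝ)
    (E : Set (EuclideanSpace ℝ (Fin n))) : EReal :=
  (inter K E (Ω \ E) : EReal) + ((σ * (inter K E Ωᶜ).toReal : ℝ) : EReal)

theorem exists_subseq_tendsto_measureReal_inter {α : Type*} [MeasurableSpace α] {μ : Measure α}
    [TopologicalSpace.SeparableSpace (Lp ℝ 2 μ)] {Ω : Set α} (hΩ : μ Ω ≠ ⊤) {E : ℕ → Set α}
    (hE : ∀ k, MeasurableSet (E k)) (hEΩ : ∀ k, E k ⊆ Ω) :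
    ∃ φ : ℕ → ℕ, StrictMono φ ∧ ∀ B, MeasurableSet B → μ B ≠ ⊤ →
      ∃ a : ℝ, Tendsto (fun k => μ.real (B ∩ E (φ k))) atTop (𝓝 a) := by
  have hfin : ∀ k, μ (E k) ≠ ⊤ := fun k => measure_ne_top_of_subset (hEΩ k) hΩ
  let u : ℕ → Lp ℝ 2 μ := fun k => indicatorConstLp 2 (hE k) (hfin k) (1 : ℝ)
  let f : ℕ → WeakDual ℝ (Lp ℝ 2 μ) := fun k =>
    StrongDual.toWeakDual (InnerProductSpace.toDual ℝ (Lp ℝ 2 μ) (u k))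
  have hf : ∀ k, f k ∈ WeakDual.toStrongDual ⁻¹'
      closedBall (0 : StrongDual ℝ (Lp ℝ 2 μ)) (√(μ.real Ω)) := by
    intro k
    have h1 : ‖u k‖ ≤ √(μ.real Ω) := by
      apply Real.le_sqrt_of_sq_le
      rw [← real_inner_self_eq_norm_sq,
        L2.inner_indicatorConstLp_indicatorConstLp (hE k) (hE k) (hfin k) (hfin k)]
      simpa using measureReal_mono (hEΩ k) hΩ
    have h2 : ‖InnerProductSpace.toDual ℝ (Lp ℝ 2 μ) (u k)‖ ≤ √(μ.real Ω) := by
      rwa [LinearIsometryEquiv.norm_map]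
    simpa [f] using h2
  obtain ⟨a, -, φ, hφ, hlim⟩ := WeakDual.isSeqCompact_closedBall ℝ (Lp ℝ 2 μ) 0 _ hf
  refine ⟨φ, hφ, fun B hB hBfin => ⟨a (indicatorConstLp 2 hB hBfin (1 : ℝ)), ?_⟩⟩
  have h := (WeakDual.eval_continuous (indicatorConstLp 2 hB hBfin (1 : ℝ))).continuousAt.tendsto.comp
    hlim
  refine h.congr fun k => ?_
  change inner ℝ (u (φ k)) (indicatorConstLp 2 hB hBfin (1 : ℝ)) = _
  rw [L2.inner_indicatorConstLp_indicatorConstLp (hE _) hB (hfin _) hBfin]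
  simp [Set.inter_comm]

theorem exists_subseq_ae_eventually_mem_iff {α : Type*} [MeasurableSpace α] {μ : Measure α}
    {E : ℕ → Set α} (hE : ∀ k, MeasurableSet (E k))
    (hcauchy : ∀ η : ℝ≥0∞, 0 < η → ∃ N, ∀ k ≥ N, ∀ l ≥ N, μ (E k \ E l) ≤ η) :
    ∃ (ψ : ℕ → ℕ) (A : Set α), StrictMono ψ ∧ MeasurableSet A ∧
      ∀ᵐ x ∂μ, ∀ᶠ k in atTop, (x ∈ E (ψ k) ↔ x ∈ A) := by
  have hev : ∀ n : ℕ, ∀ᶠ k in atTop, ∀ l ≥ k, μ (E k ∆ E l) ≤ 2 * 2⁻¹ ^ n := by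
    intro n
    obtain ⟨N, hN⟩ := hcauchy (2⁻¹ ^ n) (ENNReal.pow_pos (by simp) n)
    filter_upwards [eventually_ge_atTop N] with k hk l hl
    calc μ (E k ∆ E l) ≤ μ (E k \ E l) + μ (E l \ E k) := measure_union_le _ _
      _ ≤ 2⁻¹ ^ n + 2⁻¹ ^ n :=
        add_le_add (hN k hk l (hk.trans hl)) (hN l (hk.trans hl) k hk)
      _ = 2 * 2⁻¹ ^ n := (two_mul _).symm
  obtain ⟨ψ, hψ, hP⟩ := extraction_forall_of_eventually hev
  refine ⟨ψ, limsup (fun k => E (ψ k)) atTop, hψ,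
    MeasurableSet.measurableSet_limsup fun k => hE _, ?_⟩
  have hsum : ∑' k, μ (E (ψ k) ∆ E (ψ (k + 1))) ≠ ⊤ := by
    refine ne_top_of_le_ne_top ?_ (ENNReal.tsum_le_tsum fun k => hP k _ (hψ (Nat.lt_succ_self k)).le)
    rw [ENNReal.tsum_mul_left, ENNReal.tsum_geometric]
    simp [ENNReal.mul_eq_top]
  filter_upwards [ae_eventually_notMem hsum] with x hx
  obtain ⟨N, hN⟩ := eventually_atTop.1 hx
  have hconst : ∀ k ≥ N, (x ∈ E (ψ k) ↔ x ∈ E (ψ N)) := by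
    intro k hk
    induction k, hk using Nat.le_induction with
    | base => rfl
    | succ k hk ih =>
      rw [← ih]
      have := hN k hk
      rw [Set.mem_symmDiff] at this
      tauto
  filter_upwards [eventually_ge_atTop N] with k hk
  rw [hconst k hk, mem_limsup_iff_frequently_mem]
  constructor
  · intro h
    refine Eventually.frequently ?_
    filter_upwards [eventually_ge_atTop N] with j hj using (hconst j hj).2 h
  · intro h
    obtain ⟨j, hj, hjN⟩ := (h.and_eventually (eventually_ge_atTop N)).exists
    exact (hconst j hjN).1 hj

theorem tendsto_setLIntegral_of_ae_eventually_mem_iff {α : Type*} [MeasurableSpace α]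
    {μ : Measure α} {Ω A : Set α} (hΩ : MeasurableSet Ω) {E : ℕ → Set α}
    (hE : ∀ k, MeasurableSet (E k)) (hEΩ : ∀ k, E k ⊆ Ω) (hA : MeasurableSet A)
    (hlim : ∀ᵐ x ∂μ, ∀ᶠ k in atTop, (x ∈ E k ↔ x ∈ A)) {G : α → ℝ≥0∞}
    (hG : ∫⁻ x in Ω, G x ∂μ ≠ ⊤) :
    Tendsto (fun k => ∫⁻ x in E k, G x ∂μ) atTop (𝓝 (∫⁻ x in A, G x ∂μ)) := by
  simp_rw [← withDensity_apply G hA, ← withDensity_apply G (hE _)]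
  rw [← withDensity_apply G hΩ] at hG
  exact tendsto_measure_of_ae_tendsto_indicator atTop hA hE hΩ hG (.of_forall hEΩ)
    ((withDensity_absolutelyContinuous μ G).ae_le hlim)

theorem tendsto_setIntegral_of_ae_eventually_mem_iff {α : Type*} [MeasurableSpace α]
    {μ : Measure α} {Ω A : Set α} (hΩ : MeasurableSet Ω) {E : ℕ → Set α}
    (hE : ∀ k, MeasurableSet (E k)) (hEΩ : ∀ k, E k ⊆ Ω) (hA : MeasurableSet A)
    (hlim : ∀ᵐ x ∂μ, ∀ᶠ k in atTop, (x ∈ E k ↔ x ∈ A)) {g : α → ℝ}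
    (hg : IntegrableOn g Ω μ) :
    Tendsto (fun k => ∫ x in E k, g x ∂μ) atTop (𝓝 (∫ x in A, g x ∂μ)) := by
  simp_rw [← integral_indicator hA, ← integral_indicator (hE _)]
  refine tendsto_integral_of_dominated_convergence (fun x => ‖Ω.indicator g x‖)
    (fun k => ?_) (hg.integrable_indicator hΩ).norm (fun k => .of_forall fun x => ?_) ?_
  · exact ((hg.mono_set (hEΩ k)).integrable_indicator (hE k)).aestronglyMeasurable
  · by_cases hx : x ∈ E k
    · simp [hx, hEΩ k hx]
    · simp [hx]
  · filter_upwards [hlim] with x hx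
    refine tendsto_const_nhds.congr' ?_
    filter_upwards [hx] with k hk
    by_cases hxA : x ∈ A
    · simp [hxA, hk.2 hxA]
    · simp [hxA, mt hk.1 hxA]

theorem measurable_ofReal_kernel {n : ℕ} {K : EuclideanSpace ℝ (Fin n) → ℝ} (hK : Measurable K) :
    Measurable fun p : EuclideanSpace ℝ (Fin n) × EuclideanSpace ℝ (Fin n) =>
      ENNReal.ofReal (K (p.1 - p.2)) :=
  (hK.comp (measurable_fst.sub measurable_snd)).ennreal_ofReal

theorem measurable_lintegral_ofReal_kernel {n : ℕ} {K : EuclideanSpace ℝ (Fin n) → ℝ}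
    (hK : Measurable K) (F : Set (EuclideanSpace ℝ (Fin n))) :
    Measurable fun x => ∫⁻ y in F, ENNReal.ofReal (K (x - y)) :=
  (measurable_ofReal_kernel hK).lintegral_prod_right'

theorem inter_comm {n : ℕ} {K : EuclideanSpace ℝ (Fin n) → ℝ} (hK : Measurable K)
    (hKeven : ∀ ζ, K (-ζ) = K ζ) (E F : Set (EuclideanSpace ℝ (Fin n))) :
    inter K E F = inter K F E := by
  unfold inter
  rw [lintegral_lintegral_swap (measurable_ofReal_kernel hK).aemeasurable]
  refine lintegral_congr fun y => lintegral_congr fun x => ?_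
  rw [← hKeven, neg_sub]

theorem inter_mono {n : ℕ} (K : EuclideanSpace ℝ (Fin n) → ℝ)
    {E E' F F' : Set (EuclideanSpace ℝ (Fin n))} (hE : E ⊆ E') (hF : F ⊆ F') :
    inter K E F ≤ inter K E' F' :=
  (lintegral_mono_set hE).trans (lintegral_mono fun _ => lintegral_mono_set hF)

theorem inter_union_right_le {n : ℕ} {K : EuclideanSpace ℝ (Fin n) → ℝ} (hK : Measurable K)
    (E F G : Set (EuclideanSpace ℝ (Fin n))) :
    inter K E (F ∪ G) ≤ inter K E F + inter K E G := by
  unfold inter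
  rw [← lintegral_add_left (measurable_lintegral_ofReal_kernel hK F)]
  exact lintegral_mono fun x => lintegral_union_le _ _ _

theorem inter_eq_lintegral_prod {n : ℕ} {K : EuclideanSpace ℝ (Fin n) → ℝ} (hK : Measurable K)
    {E F : Set (EuclideanSpace ℝ (Fin n))} (hE : MeasurableSet E) (hF : MeasurableSet F) :
    inter K E F = ∫⁻ p, (E ×ˢ F).indicator (fun p => ENNReal.ofReal (K (p.1 - p.2))) p
      ∂((volume : Measure (EuclideanSpace ℝ (Fin n))).prod volume) := by
  rw [lintegral_indicator (hE.prod hF), ← Measure.prod_restrict,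
    lintegral_prod _ (measurable_ofReal_kernel hK).aemeasurable]
  rfl

theorem inter_le_liminf {n : ℕ} {K : EuclideanSpace ℝ (Fin n) → ℝ} (hK : Measurable K)
    {Ω A : Set (EuclideanSpace ℝ (Fin n))} (hΩ : MeasurableSet Ω)
    {E : ℕ → Set (EuclideanSpace ℝ (Fin n))} (hE : ∀ k, MeasurableSet (E k))
    (hA : MeasurableSet A) (hlim : ∀ᵐ x, ∀ᶠ k in atTop, (x ∈ E k ↔ x ∈ A)) :
    inter K A (Ω \ A) ≤ liminf (fun k => inter K (E k) (Ω \ E k)) atTop := by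
  simp_rw [inter_eq_lintegral_prod hK (hE _) (hΩ.diff (hE _)),
    inter_eq_lintegral_prod hK hA (hΩ.diff hA)]
  refine le_trans (lintegral_mono_ae ?_) (lintegral_liminf_le fun k =>
    (measurable_ofReal_kernel hK).indicator ((hE k).prod (hΩ.diff (hE k))))
  filter_upwards [Measure.quasiMeasurePreserving_fst.ae hlim,
    Measure.quasiMeasurePreserving_snd.ae hlim] with p h1 h2
  refine le_of_eq (Tendsto.liminf_eq (tendsto_const_nhds.congr' ?_)).symm
  filter_upwards [h1, h2] with k hk1 hk2
  have hiff : p ∈ A ×ˢ (Ω \ A) ↔ p ∈ E k ×ˢ (Ω \ E k) := by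
    simp only [Set.mem_prod, Set.mem_sdiff, hk1, hk2]
  by_cases hp : p ∈ A ×ˢ (Ω \ A)
  · rw [Set.indicator_of_mem hp, Set.indicator_of_mem (hiff.1 hp)]
  · rw [Set.indicator_of_notMem hp, Set.indicator_of_notMem (mt hiff.2 hp)]

theorem setLIntegral_measure_ball_inter_le {n : ℕ} {K : EuclideanSpace ℝ (Fin n) → ℝ}
    (hK : Measurable K) {δ : ℝ} {c : ℝ≥0∞}
    (hc : ∀ ζ, ζ ≠ 0 → ‖ζ‖ < δ → 1 ≤ c * ENNReal.ofReal (K ζ))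
    {E F : Set (EuclideanSpace ℝ (Fin n))} (hE : MeasurableSet E) (hF : MeasurableSet F)
    (hdisj : Disjoint E F) :
    ∫⁻ x in E, volume (ball x δ ∩ F) ≤ c * inter K E F := by
  unfold inter
  rw [← lintegral_const_mul _ (measurable_lintegral_ofReal_kernel hK F)]
  refine setLIntegral_mono' hE fun x hx => ?_
  rw [← lintegral_const_mul _ (by fun_prop : Measurable fun y => ENNReal.ofReal (K (x - y))),
    ← Measure.restrict_apply measurableSet_ball, ← lintegral_indicator_one measurableSet_ball]
  refine setLIntegral_mono' hF fun y hy => ?_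
  by_cases hxy : y ∈ ball x δ
  · rw [Set.indicator_of_mem hxy]
    refine hc _ (sub_ne_zero.2 (hdisj.ne_of_mem hx hy)) ?_
    rwa [← dist_eq_norm, dist_comm]
  · simp [hxy]

theorem measurable_volume_ball_inter {n : ℕ} (δ : ℝ) {E : Set (EuclideanSpace ℝ (Fin n))}
    (hE : MeasurableSet E) : Measurable fun x => volume (ball x δ ∩ E) := by
  have hS : MeasurableSet {p : EuclideanSpace ℝ (Fin n) × EuclideanSpace ℝ (Fin n) |
      dist p.2 p.1 < δ ∧ p.2 ∈ E} :=
    (measurableSet_lt (measurable_snd.dist measurable_fst) measurable_const).inter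
      (measurable_snd hE)
  exact measurable_measure_prodMk_left hS

theorem volume_ball_mul_volume_diff_le {n : ℕ} {K : EuclideanSpace ℝ (Fin n) → ℝ}
    (hK : Measurable K) (hKeven : ∀ ζ, K (-ζ) = K ζ) {δ : ℝ} {c : ℝ≥0∞}
    (hc : ∀ ζ, ζ ≠ 0 → ‖ζ‖ < δ → 1 ≤ c * ENNReal.ofReal (K ζ))
    {Ω E F : Set (EuclideanSpace ℝ (Fin n))} (hE : MeasurableSet E) (hF : MeasurableSet F)
    (hEΩ : E ⊆ Ω) :
    volume (ball (0 : EuclideanSpace ℝ (Fin n)) δ) * volume (E \ F) ≤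
      c * (inter K E Eᶜ + inter K F Fᶜ) +
        ∫⁻ x in Ω, (volume (ball x δ ∩ E) - volume (ball x δ ∩ F)) := by
  have hmE := measurable_volume_ball_inter δ hE
  have hmF := measurable_volume_ball_inter δ hF
  have hmE' := measurable_volume_ball_inter δ hE.compl
  calc volume (ball (0 : EuclideanSpace ℝ (Fin n)) δ) * volume (E \ F)
      = ∫⁻ x in E \ F, volume (ball x δ) := by
        simp_rw [Measure.addHaar_ball_center]
        rw [setLIntegral_const]
    _ ≤ ∫⁻ x in E \ F, (volume (ball x δ ∩ Eᶜ) + (volume (ball x δ ∩ F) +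
          (volume (ball x δ ∩ E) - volume (ball x δ ∩ F)))) := by
        refine lintegral_mono fun x => ?_
        calc volume (ball x δ) ≤ volume (ball x δ ∩ E) + volume (ball x δ \ E) :=
              measure_le_inter_add_sdiff _ _ _
          _ = volume (ball x δ ∩ Eᶜ) + volume (ball x δ ∩ E) := add_comm _ _
          _ ≤ _ := by gcongr; exact le_add_tsub
    _ = (∫⁻ x in E \ F, volume (ball x δ ∩ Eᶜ)) + ((∫⁻ x in E \ F, volume (ball x δ ∩ F)) +
          ∫⁻ x in E \ F, (volume (ball x δ ∩ E) - volume (ball x δ ∩ F))) := by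
        rw [lintegral_add_left hmE', lintegral_add_left hmF]
    _ ≤ (∫⁻ x in E, volume (ball x δ ∩ Eᶜ)) + ((∫⁻ x in Fᶜ, volume (ball x δ ∩ F)) +
          ∫⁻ x in Ω, (volume (ball x δ ∩ E) - volume (ball x δ ∩ F))) := by
        gcongr ?_ + (?_ + ?_)
        · exact lintegral_mono_set Set.sdiff_subset
        · exact lintegral_mono_set fun x hx => hx.2
        · exact lintegral_mono_set (Set.sdiff_subset.trans hEΩ)
    _ ≤ c * inter K E Eᶜ + (c * inter K F Fᶜ +
          ∫⁻ x in Ω, (volume (ball x δ ∩ E) - volume (ball x δ ∩ F))) := by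
        gcongr ?_ + (?_ + _)
        · exact setLIntegral_measure_ball_inter_le hK hc hE hE.compl disjoint_compl_right
        · rw [inter_comm hK hKeven F]
          exact setLIntegral_measure_ball_inter_le hK hc hF.compl hF disjoint_compl_left
    _ = _ := by rw [mul_add, add_assoc]

theorem tendsto_setLIntegral_volume_ball_inter_sub {n : ℕ} {Ω : Set (EuclideanSpace ℝ (Fin n))}
    (hΩ : volume Ω ≠ ⊤) {E : ℕ → Set (EuclideanSpace ℝ (Fin n))}
    (hE : ∀ k, MeasurableSet (E k)) {δ : ℝ}
    (hlim : ∀ x, ∃ a : ℝ, Tendsto (fun k => volume.real (ball x δ ∩ E k)) atTop (𝓝 a)) :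
    Tendsto (fun p : ℕ × ℕ => ∫⁻ x in Ω, (volume (ball x δ ∩ E p.1) - volume (ball x δ ∩ E p.2)))
      (atTop ×ˢ atTop) (𝓝 0) := by
  rw [← lintegral_zero (μ := volume.restrict Ω)]
  refine tendsto_lintegral_filter_of_dominated_convergence
    (fun _ => volume (ball (0 : EuclideanSpace ℝ (Fin n)) δ))
    (.of_forall fun p => (measurable_volume_ball_inter δ (hE _)).sub
      (measurable_volume_ball_inter δ (hE _)))
    (.of_forall fun p => .of_forall fun x => ?_) ?_ (.of_forall fun x => ?_)
  · rw [← Measure.addHaar_ball_center volume x]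
    exact tsub_le_self.trans (measure_mono Set.inter_subset_left)
  · rw [setLIntegral_const]
    exact ENNReal.mul_ne_top measure_ball_lt_top.ne hΩ
  · obtain ⟨a, ha⟩ := hlim x
    have h : Tendsto (fun k => volume (ball x δ ∩ E k)) atTop (𝓝 (ENNReal.ofReal a)) := by
      refine (ENNReal.tendsto_ofReal ha).congr fun k => ?_
      exact ofReal_measureReal (measure_ne_top_of_subset Set.inter_subset_left
        measure_ball_lt_top.ne)
    have h2 := ENNReal.Tendsto.sub (h.comp tendsto_fst) (h.comp tendsto_snd)
      (Or.inl ENNReal.ofReal_ne_top)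
    rwa [tsub_self] at h2

theorem exists_subseq_ae_eventually_mem_iff_of_inter_le {n : ℕ} (hn : 0 < n) {s lam ε : ℝ}
    (hs : 0 < s) (hlam : 0 < lam) (hε : 0 < ε)
    {K : EuclideanSpace ℝ (Fin n) → ℝ} (hK : Measurable K) (hKeven : ∀ ζ, K (-ζ) = K ζ)
    (hKlow : ∀ ζ : EuclideanSpace ℝ (Fin n), ζ ≠ 0 → ‖ζ‖ < ε →
      1 / (lam * ‖ζ‖ ^ ((n : ℝ) + s)) ≤ K ζ)
    {Ω : Set (EuclideanSpace ℝ (Fin n))} (hΩ : volume Ω ≠ ⊤)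
    {E : ℕ → Set (EuclideanSpace ℝ (Fin n))} (hE : ∀ k, MeasurableSet (E k))
    (hEΩ : ∀ k, E k ⊆ Ω) {M : ℝ≥0∞} (hM : M ≠ ⊤) (hEM : ∀ k, inter K (E k) (E k)ᶜ ≤ M) :
    ∃ (φ : ℕ → ℕ) (A : Set (EuclideanSpace ℝ (Fin n))), StrictMono φ ∧ MeasurableSet A ∧
      ∀ᵐ x, ∀ᶠ k in atTop, (x ∈ E (φ k) ↔ x ∈ A) := by
  have : Fact ((2 : ℝ≥0∞) ≠ ⊤) := ⟨by simp⟩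
  have : Nonempty (Fin n) := ⟨⟨0, hn⟩⟩
  obtain ⟨φ, hφ, hconv⟩ := exists_subseq_tendsto_measureReal_inter hΩ hE hEΩ
  suffices hcauchy : ∀ η : ℝ≥0∞, 0 < η → ∃ N, ∀ k ≥ N, ∀ l ≥ N,
      volume (E (φ k) \ E (φ l)) ≤ η by
    obtain ⟨ψ, A, hψ, hA, hlim⟩ := exists_subseq_ae_eventually_mem_iff (fun k => hE (φ k)) hcauchy
    exact ⟨φ ∘ ψ, A, hφ.comp hψ, hA, hlim⟩
  intro η hη
  set ω : ℝ≥0∞ := volume (ball (0 : EuclideanSpace ℝ (Fin n)) 1) with hω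
  have hω0 : 0 < ω := measure_ball_pos _ _ one_pos
  have hωt : ω ≠ ⊤ := measure_ball_lt_top.ne
  obtain ⟨θ, hθ, hθη⟩ : ∃ θ : ℝ≥0∞, 0 < θ ∧ θ + θ ≤ η :=
    ⟨η / 2, ENNReal.half_pos hη.ne', (ENNReal.add_halves η).le⟩
  have hsmall : ∀ᶠ δ : ℝ in 𝓝[>] 0, ENNReal.ofReal (lam * δ ^ s) * (M + M) < θ * ω := by
    have h0 : Tendsto (fun δ : ℝ => ENNReal.ofReal (lam * δ ^ s) * (M + M)) (𝓝[>] 0) (𝓝 0) := by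
      have h1 : Tendsto (fun δ : ℝ => lam * δ ^ s) (𝓝[>] 0) (𝓝 0) := by
        have h2 : ContinuousAt (fun δ : ℝ => lam * δ ^ s) 0 :=
          (Real.continuousAt_rpow_const _ _ (Or.inr hs.le)).const_mul lam
        simpa [Real.zero_rpow hs.ne'] using h2.tendsto.mono_left nhdsWithin_le_nhds
      simpa using ENNReal.Tendsto.mul_const (ENNReal.tendsto_ofReal h1)
        (Or.inr (ENNReal.add_ne_top.2 ⟨hM, hM⟩) : (_ : ℝ≥0∞) ≠ 0 ∨ M + M ≠ ⊤)
    exact h0.eventually_lt_const (ENNReal.mul_pos hθ.ne' hω0.ne')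
  obtain ⟨δ, hδM, hδ0, hδε⟩ := (hsmall.and (Ioo_mem_nhdsGT hε)).exists
  have hvol : volume (ball (0 : EuclideanSpace ℝ (Fin n)) δ) = ENNReal.ofReal (δ ^ n) * ω := by
    rw [Measure.addHaar_ball _ _ hδ0.le, finrank_euclideanSpace_fin]
  have hδn : 0 < ENNReal.ofReal (δ ^ n) := ENNReal.ofReal_pos.2 (pow_pos hδ0 n)
  have hc : ∀ ζ : EuclideanSpace ℝ (Fin n), ζ ≠ 0 → ‖ζ‖ < δ →
      1 ≤ ENNReal.ofReal (δ ^ n) * ENNReal.ofReal (lam * δ ^ s) * ENNReal.ofReal (K ζ) := by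
    intro ζ hζ hζδ
    have hζ0 : 0 < ‖ζ‖ := norm_pos_iff.2 hζ
    rw [← ENNReal.ofReal_mul (by positivity), ← ENNReal.ofReal_mul (by positivity),
      ENNReal.one_le_ofReal]
    have h1 : δ ^ n * (lam * δ ^ s) = lam * δ ^ ((n : ℝ) + s) := by
      rw [Real.rpow_add hδ0, Real.rpow_natCast]; ring
    rw [h1]
    have h2 : 0 < lam * ‖ζ‖ ^ ((n : ℝ) + s) := by positivity
    calc (1 : ℝ) = lam * ‖ζ‖ ^ ((n : ℝ) + s) * (1 / (lam * ‖ζ‖ ^ ((n : ℝ) + s))) := by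
          field_simp
      _ ≤ lam * δ ^ ((n : ℝ) + s) * K ζ := by
          have := hKlow ζ hζ (hζδ.trans hδε)
          gcongr
  have hT := (tendsto_setLIntegral_volume_ball_inter_sub hΩ (fun k => hE (φ k)) (δ := δ)
    (fun x => hconv _ measurableSet_ball measure_ball_lt_top.ne)).eventually_le_const
    (ENNReal.mul_pos hδn.ne' (ENNReal.mul_pos hθ.ne' hω0.ne').ne')
  rw [prod_atTop_atTop_eq] at hT
  obtain ⟨⟨N₁, N₂⟩, hN⟩ := eventually_atTop.1 hT
  refine ⟨max N₁ N₂, fun k hk l hl => ?_⟩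
  have hTkl := hN (k, l) ⟨(le_max_left _ _).trans hk, (le_max_right _ _).trans hl⟩
  have key := volume_ball_mul_volume_diff_le hK hKeven hc (hE (φ k)) (hE (φ l)) (hEΩ (φ k))
  have hbound : ENNReal.ofReal (δ ^ n) * ω * volume (E (φ k) \ E (φ l)) ≤
      ENNReal.ofReal (δ ^ n) * ω * η := by
    calc _ ≤ ENNReal.ofReal (δ ^ n) * ENNReal.ofReal (lam * δ ^ s) * (M + M) +
          ENNReal.ofReal (δ ^ n) * (θ * ω) := by
            rw [← hvol]
            exact key.trans (add_le_add (by gcongr <;> exact hEM _) hTkl)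
      _ ≤ ENNReal.ofReal (δ ^ n) * (θ * ω) + ENNReal.ofReal (δ ^ n) * (θ * ω) := by
            rw [mul_assoc]; gcongr
      _ = ENNReal.ofReal (δ ^ n) * ω * (θ + θ) := by ring
      _ ≤ _ := by gcongr
  exact (ENNReal.mul_le_mul_iff_right (mul_ne_zero hδn.ne' hω0.ne')
    (ENNReal.mul_ne_top ENNReal.ofReal_ne_top hωt)).1 hbound

theorem pow_succ_le_mul_add_sub_pow {r t : ℝ} (ht : 0 ≤ t) (htr : t ≤ r) (k : ℕ) :
    r ^ (k + 1) ≤ (k + 1) * r ^ k * t + (r - t) ^ (k + 1) := by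
  induction k with
  | zero => simp
  | succ k ih =>
    have h1 : (r - t) ^ (k + 1) ≤ r ^ (k + 1) :=
      pow_le_pow_left₀ (sub_nonneg.2 htr) (by linarith) _
    calc r ^ (k + 1 + 1) = r * r ^ (k + 1) := by ring
      _ ≤ r * ((k + 1) * r ^ k * t + (r - t) ^ (k + 1)) :=
        mul_le_mul_of_nonneg_left ih (ht.trans htr)
      _ = (k + 1) * r ^ (k + 1) * t + t * (r - t) ^ (k + 1) + (r - t) ^ (k + 1 + 1) := by ring
      _ ≤ (k + 1) * r ^ (k + 1) * t + t * r ^ (k + 1) + (r - t) ^ (k + 1 + 1) := by gcongr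
      _ = _ := by push_cast; ring

theorem volume_ball_diff_ball_le {n : ℕ} (hn : 0 < n) {r t : ℝ} (hr : 0 ≤ r) (ht : 0 ≤ t) :
    volume (ball (0 : EuclideanSpace ℝ (Fin n)) r \ ball 0 (r - t)) ≤
      ENNReal.ofReal (n * r ^ (n - 1)) * volume (ball (0 : EuclideanSpace ℝ (Fin n)) 1) *
        ENNReal.ofReal t := by
  have : Nonempty (Fin n) := ⟨⟨0, hn⟩⟩
  obtain ⟨k, rfl⟩ : ∃ k, n = k + 1 := ⟨n - 1, by omega⟩
  rw [mul_right_comm, ← ENNReal.ofReal_mul (by positivity)]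
  simp only [Nat.add_sub_cancel, Nat.cast_add, Nat.cast_one]
  rcases le_total t r with htr | htr
  · rw [measure_sdiff (ball_subset_ball (by linarith)) measurableSet_ball.nullMeasurableSet
      measure_ball_lt_top.ne, tsub_le_iff_right, Measure.addHaar_ball _ _ hr,
      Measure.addHaar_ball _ _ (sub_nonneg.2 htr), finrank_euclideanSpace_fin, ← add_mul,
      ← ENNReal.ofReal_add (by positivity) (pow_nonneg (sub_nonneg.2 htr) _)]
    gcongr
    exact pow_succ_le_mul_add_sub_pow ht htr k
  · refine (measure_mono Set.sdiff_subset).trans ?_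
    rw [Measure.addHaar_ball _ _ hr, finrank_euclideanSpace_fin]
    gcongr
    calc r ^ (k + 1) = 1 * r ^ k * r := by ring
      _ ≤ (k + 1) * r ^ k * t := by gcongr; simp

theorem inter_ball_ne_top {n : ℕ} (hn : 0 < n) {s lam : ℝ} (hs : s < 1)
    {K : EuclideanSpace ℝ (Fin n) → ℝ} (hK : Measurable K) (hKnonneg : ∀ ζ, 0 ≤ K ζ)
    (hKup : ∀ ζ : EuclideanSpace ℝ (Fin n), ζ ≠ 0 → K ζ ≤ lam / ‖ζ‖ ^ ((n : ℝ) + s))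
    {Ω : Set (EuclideanSpace ℝ (Fin n))} (hΩm : MeasurableSet Ω) {R : ℝ} (hΩ : Ω ⊆ ball 0 R)
    {r : ℝ} (hr : 0 ≤ r) :
    inter K (Ω ∩ ball 0 r) (Ω \ (Ω ∩ ball 0 r)) ≠ ⊤ := by
  have : Nonempty (Fin n) := ⟨⟨0, hn⟩⟩
  set D : Set (EuclideanSpace ℝ (Fin n) × EuclideanSpace ℝ (Fin n)) :=
    {p | p.1 ∈ ball 0 r ∧ p.1 - p.2 ∉ ball 0 r ∧ p.2 ∈ ball 0 (R + R)} with hD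
  have hDm : MeasurableSet D :=
    (measurable_fst measurableSet_ball).inter
      (((measurable_fst.sub measurable_snd) measurableSet_ball.compl).inter
        (measurable_snd measurableSet_ball))
  have hKm : Measurable fun p : EuclideanSpace ℝ (Fin n) × EuclideanSpace ℝ (Fin n) =>
      D.indicator (fun p => ENNReal.ofReal (K p.2)) p :=
    ((hK.comp measurable_snd).ennreal_ofReal).indicator hDm
  set c : ℝ≥0∞ := ENNReal.ofReal (n * r ^ (n - 1)) *
    volume (ball (0 : EuclideanSpace ℝ (Fin n)) 1) with hcdef
  have hc : c ≠ ⊤ := ENNReal.mul_ne_top ENNReal.ofReal_ne_top measure_ball_lt_top.ne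
  have hint : IntegrableOn (fun ζ => K ζ * ‖ζ‖) (ball 0 (R + R)) := by
    refine integrableOn_ball_of_norm_le_rpow (C := lam) (α := (n : ℝ) + s - 1) ?_ ?_ ?_ ?_
    · rw [finrank_euclideanSpace_fin]; omega
    · rw [finrank_euclideanSpace_fin]; linarith
    · have hne : ∀ᵐ ζ : EuclideanSpace ℝ (Fin n), ζ ≠ 0 := by
        simp [ae_iff]
      filter_upwards [ae_restrict_of_ae hne] with ζ hζ
      have hζ0 : 0 < ‖ζ‖ := norm_pos_iff.2 hζ
      rw [Real.norm_of_nonneg (mul_nonneg (hKnonneg ζ) hζ0.le)]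
      calc K ζ * ‖ζ‖ ≤ lam / ‖ζ‖ ^ ((n : ℝ) + s) * ‖ζ‖ := by gcongr; exact hKup ζ hζ
        _ = lam * ‖ζ‖ ^ (-((n : ℝ) + s - 1)) := by
          rw [neg_sub, Real.rpow_sub hζ0, Real.rpow_one]; ring
    · exact (hK.mul measurable_norm).aestronglyMeasurable
  have hfin : ∫⁻ ζ in ball 0 (R + R), ENNReal.ofReal (K ζ * ‖ζ‖) ≠ ⊤ :=
    hint.lintegral_lt_top.ne
  refine ne_top_of_le_ne_top (ENNReal.mul_ne_top hc hfin) ?_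
  calc inter K (Ω ∩ ball 0 r) (Ω \ (Ω ∩ ball 0 r))
      ≤ ∫⁻ x, ∫⁻ y, D.indicator (fun p => ENNReal.ofReal (K p.2)) (x, x - y) := by
        have hEm : MeasurableSet (Ω ∩ ball (0 : EuclideanSpace ℝ (Fin n)) r) :=
          hΩm.inter measurableSet_ball
        have hKm' : Measurable fun p : EuclideanSpace ℝ (Fin n) × EuclideanSpace ℝ (Fin n) =>
            D.indicator (fun p => ENNReal.ofReal (K p.2)) (p.1, p.1 - p.2) :=
          hKm.comp (measurable_fst.prodMk (measurable_fst.sub measurable_snd))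
        rw [inter_eq_lintegral_prod hK hEm (hΩm.diff hEm), ← lintegral_prod _ hKm'.aemeasurable]
        refine lintegral_mono (Set.indicator_le (g := fun p : EuclideanSpace ℝ (Fin n) ×
          EuclideanSpace ℝ (Fin n) => D.indicator (fun p => ENNReal.ofReal (K p.2)) (p.1, p.1 - p.2))
          fun q hq => ?_)
        have hqD : (q.1, q.1 - q.2) ∈ D := by
          obtain ⟨⟨h1, h1'⟩, h2, h2'⟩ := hq
          refine ⟨h1', fun h => h2' ⟨h2, by simpa using h⟩, ?_⟩
          have h3 := mem_ball_zero_iff.1 (hΩ h1)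
          have h4 := mem_ball_zero_iff.1 (hΩ h2)
          exact mem_ball_zero_iff.2 ((norm_sub_le _ _).trans_lt (add_lt_add h3 h4))
        rw [Set.indicator_of_mem hqD]
    _ = ∫⁻ x, ∫⁻ h, D.indicator (fun p => ENNReal.ofReal (K p.2)) (x, h) := by
        refine lintegral_congr fun x => ?_
        exact lintegral_sub_left_eq_self
          (fun h => D.indicator (fun p => ENNReal.ofReal (K p.2)) (x, h)) x
    _ = ∫⁻ h, ∫⁻ x, D.indicator (fun p => ENNReal.ofReal (K p.2)) (x, h) :=
        lintegral_lintegral_swap hKm.aemeasurable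
    _ ≤ ∫⁻ h, (ball 0 (R + R)).indicator (fun h => c * ENNReal.ofReal (K h * ‖h‖)) h := by
        refine lintegral_mono fun h => ?_
        by_cases hh : h ∈ ball 0 (R + R)
        · rw [Set.indicator_of_mem hh]
          calc ∫⁻ x, D.indicator (fun p => ENNReal.ofReal (K p.2)) (x, h)
              ≤ ∫⁻ x, (ball (0 : EuclideanSpace ℝ (Fin n)) r \ ball 0 (r - ‖h‖)).indicator
                  (fun _ => ENNReal.ofReal (K h)) x := by
                refine lintegral_mono fun x => ?_
                by_cases hx : (x, h) ∈ D
                · rw [Set.indicator_of_mem hx, Set.indicator_of_mem]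
                  refine ⟨hx.1, fun hx' => hx.2.1 ?_⟩
                  rw [mem_ball_zero_iff] at hx' ⊢
                  calc ‖x - h‖ ≤ ‖x‖ + ‖h‖ := norm_sub_le _ _
                    _ < r := by linarith
                · simp [hx]
            _ ≤ ENNReal.ofReal (K h) * (c * ENNReal.ofReal ‖h‖) := by
                rw [lintegral_indicator_const (measurableSet_ball.diff measurableSet_ball)]
                gcongr
                exact volume_ball_diff_ball_le hn hr (norm_nonneg h)
            _ = _ := by rw [ENNReal.ofReal_mul (hKnonneg h)]; ring
        · rw [Set.indicator_of_notMem hh]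
          have h0 : ∀ x, (x, h) ∉ D := fun x hx => hh hx.2.2
          simp [h0]
    _ = c * ∫⁻ ζ in ball 0 (R + R), ENNReal.ofReal (K ζ * ‖ζ‖) := by
        rw [lintegral_indicator measurableSet_ball, lintegral_const_mul]
        fun_prop

theorem exists_volume_inter_ball_eq {n : ℕ} (hn : 0 < n) {Ω : Set (EuclideanSpace ℝ (Fin n))}
    (hΩ : MeasurableSet Ω) {R : ℝ} (hR : 0 ≤ R) (hΩR : Ω ⊆ ball 0 R) {m : ℝ≥0∞}
    (hm : m ≤ volume Ω) : ∃ r : ℝ, 0 ≤ r ∧ volume (Ω ∩ ball 0 r) = m := by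
  have : Nonempty (Fin n) := ⟨⟨0, hn⟩⟩
  have hcont : Continuous fun r : ℝ => volume (Ω ∩ ball (0 : EuclideanSpace ℝ (Fin n)) r) := by
    refine continuous_iff_continuousAt.2 fun r => ?_
    refine tendsto_measure_of_ae_tendsto_indicator (𝓝 r) (hΩ.inter measurableSet_ball)
      (fun _ => hΩ.inter measurableSet_ball) hΩ
      (measure_ne_top_of_subset hΩR measure_ball_lt_top.ne)
      (.of_forall fun _ => Set.inter_subset_left) ?_
    have hne : ∀ᵐ x : EuclideanSpace ℝ (Fin n), x ∉ sphere (0 : EuclideanSpace ℝ (Fin n)) r :=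
      measure_eq_zero_iff_ae_notMem.1 (Measure.addHaar_sphere _ _ _)
    filter_upwards [hne] with x hx
    rw [mem_sphere_zero_iff_norm] at hx
    rcases lt_or_gt_of_ne hx with h | h
    · filter_upwards [lt_mem_nhds h] with t ht
      simp [h, ht]
    · filter_upwards [gt_mem_nhds h] with t ht
      simp [not_lt.2 h.le, not_lt.2 ht.le]
  obtain ⟨r, hr, hrm⟩ := intermediate_value_Icc hR hcont.continuousOn
    (show m ∈ Set.Icc _ _ by simpa [Set.inter_eq_left.2 hΩR] using hm)
  exact ⟨r, hr.1, hrm⟩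

theorem abs_mul_toReal_add_setIntegral_le {n : ℕ} (K : EuclideanSpace ℝ (Fin n) → ℝ)
    {Ω F : Set (EuclideanSpace ℝ (Fin n))} (hΩ : volume Ω ≠ ⊤) (hP : inter K Ω Ωᶜ ≠ ⊤)
    (σ : ℝ) {g : EuclideanSpace ℝ (Fin n) → ℝ} {C : ℝ} (hgb : ∀ x ∈ Ω, |g x| ≤ C) (hF : F ⊆ Ω) :
    |σ * (inter K F Ωᶜ).toReal + ∫ x in F, g x| ≤
      |σ| * (inter K Ω Ωᶜ).toReal + |C| * volume.real Ω := by
  refine (abs_add_le _ _).trans (add_le_add ?_ ?_)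
  · rw [abs_mul, abs_of_nonneg ENNReal.toReal_nonneg]
    gcongr
    exact inter_mono K hF subset_rfl
  · refine (norm_setIntegral_le_of_norm_le_const (f := g) (C := |C|)
      (measure_ne_top_of_subset hF hΩ).lt_top
      fun x hx => (hgb x (hF hx)).trans (le_abs_self C)).trans ?_
    gcongr

theorem capEnergy_add_coe {n : ℕ} (K : EuclideanSpace ℝ (Fin n) → ℝ)
    (Ω : Set (EuclideanSpace ℝ (Fin n))) (σ : ℝ) (E : Set (EuclideanSpace ℝ (Fin n))) (b : ℝ) :
    capEnergy K Ω σ E + (b : EReal) =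
      (inter K E (Ω \ E) : EReal) + ((σ * (inter K E Ωᶜ).toReal + b : ℝ) : EReal) := by
  rw [capEnergy, add_assoc, EReal.coe_add]

theorem coe_add_le_of_le_liminf {I : ℕ → ℝ≥0∞} {r : ℕ → ℝ} {I₀ : ℝ≥0∞} {r₀ : ℝ} {γ : EReal}
    (hI : I₀ ≤ liminf I atTop) (hr : Tendsto r atTop (𝓝 r₀))
    (hγ : Tendsto (fun k => (I k : EReal) + (r k : EReal)) atTop (𝓝 γ)) :
    (I₀ : EReal) + (r₀ : EReal) ≤ γ := by
  have hneg : Tendsto (fun k => ((-r k : ℝ) : EReal)) atTop (𝓝 ((-r₀ : ℝ) : EReal)) :=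
    (continuous_coe_real_ereal.tendsto _).comp hr.neg
  have hsub : Tendsto (fun k => (I k : EReal)) atTop (𝓝 (γ + ((-r₀ : ℝ) : EReal))) := by
    have h := (EReal.continuousAt_add (p := (γ, ((-r₀ : ℝ) : EReal)))
      (Or.inr (EReal.coe_ne_bot _)) (Or.inr (EReal.coe_ne_top _))).tendsto.comp
      (hγ.prodMk_nhds hneg)
    refine h.congr fun k => ?_
    simp only [Function.comp_apply]
    rw [add_assoc, ← EReal.coe_add, add_neg_cancel, EReal.coe_zero, add_zero]
  have hlim : (I₀ : EReal) ≤ γ + ((-r₀ : ℝ) : EReal) := by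
    rw [← hsub.liminf_eq]
    have hmono : Monotone ((↑) : ℝ≥0∞ → EReal) := fun a b h =>
      EReal.coe_ennreal_le_coe_ennreal_iff.2 h
    have := hmono.map_liminf_of_continuousAt (F := atTop) I
      continuous_coe_ennreal_ereal.continuousAt
    exact (hmono hI).trans this.le
  calc (I₀ : EReal) + (r₀ : EReal) ≤ γ + ((-r₀ : ℝ) : EReal) + (r₀ : EReal) := by gcongr
    _ = γ := by rw [add_assoc, ← EReal.coe_add, neg_add_cancel, EReal.coe_zero, add_zero]

/-- Existence of minimizers for the nonlocal capillarity problem. -/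
theorem stmt0 (n : ℕ) (hn : 2 ≤ n) (s lam ε : ℝ) (hs : s ∈ Set.Ioo (0 : ℝ) 1)
    (hlam : 1 ≤ lam) (hε : 0 < ε)
    (K : EuclideanSpace ℝ (Fin n) → ℝ) (hKmeas : Measurable K)
    (hKeven : ∀ ζ, K (-ζ) = K ζ) (hKnonneg : ∀ ζ, 0 ≤ K ζ)
    (hKlow : ∀ ζ : EuclideanSpace ℝ (Fin n), ζ ≠ 0 → ‖ζ‖ < ε →
      1 / (lam * ‖ζ‖ ^ ((n : ℝ) + s)) ≤ K ζ)
    (hKup : ∀ ζ : EuclideanSpace ℝ (Fin n), ζ ≠ 0 → K ζ ≤ lam / ‖ζ‖ ^ ((n : ℝ) + s))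
    (Ω : Set (EuclideanSpace ℝ (Fin n))) (hΩo : IsOpen Ω) (hΩb : Bornology.IsBounded Ω)
    (hP : inter K Ω Ωᶜ ≠ ⊤)
    (σ : ℝ) (hσ : σ ∈ Set.Ioo (-1 : ℝ) 1)
    (g : EuclideanSpace ℝ (Fin n) → ℝ) (hg : Measurable g)
    (C : ℝ) (hgb : ∀ x ∈ Ω, |g x| ≤ C)
    (m : ℝ≥0∞) (hm0 : 0 < m) (hmΩ : m < volume Ω) :
    (∃ E : Set (EuclideanSpace ℝ (Fin n)), MeasurableSet E ∧ E ⊆ Ω ∧ volume E = m ∧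
      ∀ F : Set (EuclideanSpace ℝ (Fin n)), MeasurableSet F → F ⊆ Ω → volume F = m →
        capEnergy K Ω σ E + ((∫ x in E, g x : ℝ) : EReal)
          ≤ capEnergy K Ω σ F + ((∫ x in F, g x : ℝ) : EReal)) ∧
    (∀ E : Set (EuclideanSpace ℝ (Fin n)), MeasurableSet E → E ⊆ Ω → volume E = m →
      (∀ F : Set (EuclideanSpace ℝ (Fin n)), MeasurableSet F → F ⊆ Ω → volume F = m →
        capEnergy K Ω σ E + ((∫ x in E, g x : ℝ) : EReal)
          ≤ capEnergy K Ω σ F + ((∫ x in F, g x : ℝ) : EReal)) →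
      inter K E (Ω \ E) ≠ ⊤) := by
  have hn0 : 0 < n := by omega
  obtain ⟨R, hR, hΩR⟩ := hΩb.subset_ball_lt 0 0
  have hΩm : MeasurableSet Ω := hΩo.measurableSet
  have hΩfin : volume Ω ≠ ⊤ := measure_ne_top_of_subset hΩR measure_ball_lt_top.ne
  simp_rw [capEnergy_add_coe]
  set r : Set (EuclideanSpace ℝ (Fin n)) → ℝ := fun F =>
    σ * (inter K F Ωᶜ).toReal + ∫ x in F, g x with hr
  set J : Set (EuclideanSpace ℝ (Fin n)) → EReal := fun F =>
    (inter K F (Ω \ F) : EReal) + (r F : EReal) with hJ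
  obtain ⟨F₀, hF₀m, hF₀Ω, hF₀v, hF₀fin⟩ : ∃ F : Set (EuclideanSpace ℝ (Fin n)),
      MeasurableSet F ∧ F ⊆ Ω ∧ volume F = m ∧ inter K F (Ω \ F) ≠ ⊤ := by
    obtain ⟨t, ht, htm⟩ := exists_volume_inter_ball_eq hn0 hΩm hR.le hΩR hmΩ.le
    exact ⟨Ω ∩ ball 0 t, hΩm.inter measurableSet_ball, Set.inter_subset_left, htm,
      inter_ball_ne_top hn0 hs.2 hKmeas hKnonneg hKup hΩm hΩR ht⟩
  have hJ₀ : J F₀ < ⊤ :=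
    EReal.add_lt_top (by simpa using hF₀fin) (EReal.coe_ne_top _)
  have hfin_of_lt : ∀ F, J F < ⊤ → inter K F (Ω \ F) ≠ ⊤ := by
    intro F hF htop
    simp [hJ, htop] at hF
  refine ⟨?_, fun E _ _ _ hmin => hfin_of_lt E ((hmin F₀ hF₀m hF₀Ω hF₀v).trans_lt hJ₀)⟩
  obtain ⟨u, -, hu, huS⟩ := exists_seq_tendsto_sInf
    (S := J '' {F | MeasurableSet F ∧ F ⊆ Ω ∧ volume F = m})
    ⟨_, Set.mem_image_of_mem J ⟨hF₀m, hF₀Ω, hF₀v⟩⟩ (OrderBot.bddBelow _)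
  set γ := sInf (J '' {F | MeasurableSet F ∧ F ⊆ Ω ∧ volume F = m})
  have hγ : ∀ F, MeasurableSet F → F ⊆ Ω → volume F = m → γ ≤ J F := fun F h1 h2 h3 =>
    sInf_le (Set.mem_image_of_mem J ⟨h1, h2, h3⟩)
  choose E hE hEu using huS
  obtain ⟨c, hγc, -⟩ := EReal.lt_iff_exists_real_btwn.1 ((hγ F₀ hF₀m hF₀Ω hF₀v).trans_lt hJ₀)
  obtain ⟨N, hN⟩ := eventually_atTop.1 (hu.eventually_lt_const hγc)
  set B : ℝ := |σ| * (inter K Ω Ωᶜ).toReal + |C| * volume.real Ω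
  have hB : ∀ F ⊆ Ω, |r F| ≤ B := fun F hF =>
    abs_mul_toReal_add_setIntegral_le K hΩfin hP σ hgb hF
  have hEM : ∀ k, inter K (E (k + N)) (E (k + N))ᶜ ≤
      ENNReal.ofReal (c + B) + inter K Ω Ωᶜ := by
    intro k
    have hEΩ := (hE (k + N)).2.1
    have hcompl : (E (k + N))ᶜ ⊆ (Ω \ E (k + N)) ∪ Ωᶜ := by
      intro x hx
      by_cases hxΩ : x ∈ Ω
      · exact Or.inl ⟨hxΩ, hx⟩
      · exact Or.inr hxΩ
    refine (inter_mono K subset_rfl hcompl).trans ((inter_union_right_le hKmeas _ _ _).trans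
      (add_le_add ?_ (inter_mono K hEΩ subset_rfl)))
    have hlt : J (E (k + N)) < c := by
      rw [hEu]
      exact hN _ (Nat.le_add_left _ _)
    have hne := hfin_of_lt _ (hlt.trans (EReal.coe_lt_top c))
    rw [← ENNReal.ofReal_toReal hne]
    apply ENNReal.ofReal_le_ofReal
    have hcoe : (inter K (E (k + N)) (Ω \ E (k + N)) : EReal) =
        (((inter K (E (k + N)) (Ω \ E (k + N))).toReal : ℝ) : EReal) :=
      (EReal.coe_ennreal_toReal hne).symm
    simp only [hJ] at hlt
    rw [hcoe, ← EReal.coe_add, EReal.coe_lt_coe_iff] at hlt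
    linarith [neg_abs_le (r (E (k + N))), hB _ hEΩ]
  obtain ⟨φ, A, hφ, hA, hlim⟩ := exists_subseq_ae_eventually_mem_iff_of_inter_le hn0 hs.1
    (by linarith) hε hKmeas hKeven hKlow hΩfin (fun k => (hE (k + N)).1)
    (fun k => (hE (k + N)).2.1) (ENNReal.add_ne_top.2 ⟨ENNReal.ofReal_ne_top, hP⟩) hEM
  set G : ℕ → Set (EuclideanSpace ℝ (Fin n)) := fun k => E (φ k + N)
  have hG : ∀ k, MeasurableSet (G k) := fun k => (hE _).1
  have hGΩ : ∀ k, G k ⊆ Ω := fun k => (hE _).2.1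
  have hlim' : ∀ᵐ x, ∀ᶠ k in atTop, (x ∈ G k ↔ x ∈ A ∩ Ω) := by
    filter_upwards [hlim] with x hx
    filter_upwards [hx] with k hk
    exact ⟨fun h => ⟨hk.1 h, hGΩ k h⟩, fun h => hk.2 h.1⟩
  have hAm := hA.inter hΩm
  refine ⟨A ∩ Ω, hAm, Set.inter_subset_right, ?_, fun F h1 h2 h3 => le_trans ?_ (hγ F h1 h2 h3)⟩
  · refine tendsto_nhds_unique (tendsto_measure_of_ae_tendsto_indicator atTop hAm hG hΩm hΩfin
      (.of_forall hGΩ) hlim') (tendsto_const_nhds.congr fun k => ((hE _).2.2).symm)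
  · refine coe_add_le_of_le_liminf (I := fun k => inter K (G k) (Ω \ G k)) (r := fun k => r (G k))
      (inter_le_liminf hKmeas hΩm hG hAm hlim') ?_ ?_
    · refine Tendsto.add (Tendsto.const_mul _ ?_)
        (tendsto_setIntegral_of_ae_eventually_mem_iff hΩm hG hGΩ hAm hlim' ?_)
      · exact (ENNReal.tendsto_toReal (ne_top_of_le_ne_top hP
          (inter_mono K Set.inter_subset_right subset_rfl))).comp
          (tendsto_setLIntegral_of_ae_eventually_mem_iff hΩm hG hGΩ hAm hlim' hP)
      · exact Measure.integrableOn_of_bounded hΩfin hg.aestronglyMeasurable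
          (ae_restrict_of_forall_mem hΩm hgb)
    · have hsub : Tendsto (fun k => φ k + N) atTop atTop :=
        (tendsto_add_atTop_nat N).comp hφ.tendsto_atTop
      exact (hu.comp hsub).congr fun k => (hEu _).symm
end

section
/- For every θ ∈ (0, π/2), lim_{s→1⁻} ∫₀^θ ∫₀^∞ r (r² + 2r cos t + 1)^{−(2+s)/2} dr dt = sin θ / (1 + cos θ). -/
open MeasureTheory Filter
open scoped Topology

lemma one_add_sq_le_quadratic {r c : ℝ} (hr : 0 ≤ r) (hc : 0 ≤ c) :
    1 + r ^ 2 ≤ r ^ 2 + 2 * r * c + 1 := by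
  nlinarith [mul_nonneg hr hc]

lemma integrable_one_add_sq_rpow :
    Integrable (fun r : ℝ => (1 + r ^ 2) ^ (-(3 / 4) : ℝ)) := by
  have h := integrable_rpow_neg_one_add_norm_sq (E := ℝ) (μ := volume) (r := 3 / 2)
    (by norm_num)
  refine h.congr (Eventually.of_forall fun r => ?_)
  norm_num

lemma norm_mul_quadratic_rpow_le {r c s : ℝ} (hr : 0 ≤ r) (hc : 0 ≤ c) (hs : 1 / 2 ≤ s) :
    ‖r * (r ^ 2 + 2 * r * c + 1) ^ (-((2 + s) / 2))‖ ≤ (1 + r ^ 2) ^ (-(3 / 4) : ℝ) := by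
  have hq := one_add_sq_le_quadratic hr hc
  have hpos : 0 < 1 + r ^ 2 := by positivity
  have hr' : r ≤ (1 + r ^ 2) ^ (1 / 2 : ℝ) := by
    rw [← Real.sqrt_eq_rpow]
    exact Real.le_sqrt_of_sq_le (by linarith)
  have hp : (r ^ 2 + 2 * r * c + 1) ^ (-((2 + s) / 2)) ≤ (1 + r ^ 2) ^ (-(5 / 4) : ℝ) :=
    (Real.rpow_le_rpow_of_nonpos hpos hq (by linarith)).trans
      (Real.rpow_le_rpow_of_exponent_le (by nlinarith) (by linarith))
  have h0 : 0 ≤ (r ^ 2 + 2 * r * c + 1) ^ (-((2 + s) / 2)) :=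
    Real.rpow_nonneg (hpos.le.trans hq) _
  rw [Real.norm_of_nonneg (mul_nonneg hr h0)]
  calc r * (r ^ 2 + 2 * r * c + 1) ^ (-((2 + s) / 2))
      ≤ (1 + r ^ 2) ^ (1 / 2 : ℝ) * (1 + r ^ 2) ^ (-(5 / 4) : ℝ) := by gcongr
    _ = (1 + r ^ 2) ^ (-(3 / 4) : ℝ) := by
      rw [← Real.rpow_add hpos]; norm_num

lemma tendsto_integral_mul_quadratic_rpow {c : ℝ} (hc : 0 ≤ c) :
    Tendsto (fun s : ℝ => ∫ r in Set.Ioi (0 : ℝ),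
        r * (r ^ 2 + 2 * r * c + 1) ^ (-((2 + s) / 2)))
      (𝓝[<] (1 : ℝ))
      (𝓝 (∫ r in Set.Ioi (0 : ℝ), r * (r ^ 2 + 2 * r * c + 1) ^ (-((2 + 1) / 2) : ℝ))) := by
  refine tendsto_integral_filter_of_dominated_convergence
    (fun r => (1 + r ^ 2) ^ (-(3 / 4) : ℝ)) ?_ ?_ integrable_one_add_sq_rpow.integrableOn ?_
  · exact Eventually.of_forall fun s => by
      apply Measurable.aestronglyMeasurable
      fun_prop
  · filter_upwards [Ioo_mem_nhdsLT (show (1 / 2 : ℝ) < 1 by norm_num)] with s hs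
    filter_upwards [ae_restrict_mem measurableSet_Ioi] with r hr
    exact norm_mul_quadratic_rpow_le (le_of_lt hr) hc hs.1.le
  · filter_upwards [ae_restrict_mem measurableSet_Ioi] with r hr
    have hq : 0 < r ^ 2 + 2 * r * c + 1 :=
      lt_of_lt_of_le (by positivity) (one_add_sq_le_quadratic (le_of_lt hr) hc)
    have : Continuous fun s : ℝ => r * (r ^ 2 + 2 * r * c + 1) ^ (-((2 + s) / 2)) :=
      continuous_const.mul (continuous_const.rpow (by fun_prop) fun _ => Or.inl hq.ne')
    exact (this.tendsto 1).mono_left nhdsWithin_le_nhds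

lemma integral_mul_quadratic_rpow {c : ℝ} (hc : 0 ≤ c) (hc1 : c < 1) :
    ∫ r in Set.Ioi (0 : ℝ), r * (r ^ 2 + 2 * r * c + 1) ^ (-((2 + 1) / 2) : ℝ)
      = 1 / (1 + c) := by
  have hd : 1 - c ^ 2 ≠ 0 := by nlinarith
  have hq : ∀ r ∈ Set.Ici (0 : ℝ), 0 < r ^ 2 + 2 * r * c + 1 := fun r hr =>
    lt_of_lt_of_le (by positivity) (one_add_sq_le_quadratic hr hc)
  have hderiv : ∀ r ∈ Set.Ici (0 : ℝ), HasDerivAt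
      (fun r : ℝ => -(c * r + 1) / (1 - c ^ 2) * (r ^ 2 + 2 * r * c + 1) ^ (-(1 / 2) : ℝ))
      (r * (r ^ 2 + 2 * r * c + 1) ^ (-((2 + 1) / 2) : ℝ)) r := by
    intro r hr
    have hQ : HasDerivAt (fun r : ℝ => r ^ 2 + 2 * r * c + 1) (2 * r + 2 * c) r := by
      have := (((hasDerivAt_id r).pow 2).add
        (((hasDerivAt_id r).const_mul 2).mul_const c)).add_const 1
      exact this.congr_deriv (by simp)
    have hL : HasDerivAt (fun r : ℝ => -(c * r + 1) / (1 - c ^ 2)) (-c / (1 - c ^ 2)) r := by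
      have := ((((hasDerivAt_id r).const_mul c).add_const 1).neg).div_const (1 - c ^ 2)
      exact this.congr_deriv (by simp)
    have h := hL.mul (hQ.rpow_const (p := -(1 / 2)) (Or.inl (hq r hr).ne'))
    refine h.congr_deriv ?_
    have e : (r ^ 2 + 2 * r * c + 1) ^ (-(1 / 2) : ℝ)
        = (r ^ 2 + 2 * r * c + 1) * (r ^ 2 + 2 * r * c + 1) ^ (-((2 + 1) / 2) : ℝ) := by
      rw [← Real.rpow_one_add' (hq r hr).le (by norm_num)]; norm_num
    have e' : (-(1 / 2) - 1 : ℝ) = -((2 + 1) / 2) := by norm_num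
    rw [e', e]
    field_simp
    ring
  have hlim : Tendsto
      (fun r : ℝ => -(c * r + 1) / (1 - c ^ 2) * (r ^ 2 + 2 * r * c + 1) ^ (-(1 / 2) : ℝ))
      atTop (𝓝 (-c / (1 - c ^ 2))) := by
    have hg : ContinuousAt (fun u : ℝ =>
        -(c + u) / (1 - c ^ 2) * (1 + 2 * c * u + u ^ 2) ^ (-(1 / 2) : ℝ)) 0 := by
      refine ContinuousAt.mul (by fun_prop) (ContinuousAt.rpow_const (by fun_prop) ?_)
      left; norm_num
    have h := hg.tendsto.comp tendsto_inv_atTop_zero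
    simp only [add_zero, mul_zero, ne_eq, OfNat.ofNat_ne_zero, not_false_eq_true, zero_pow,
      Real.one_rpow, mul_one] at h
    refine h.congr' ?_
    filter_upwards [eventually_gt_atTop 0] with r hr
    have e : 1 + 2 * c * r⁻¹ + r⁻¹ ^ 2 = (r ^ 2 + 2 * r * c + 1) / r ^ 2 := by
      field_simp
    have e2 : (r ^ 2) ^ (-(1 / 2) : ℝ) = r⁻¹ := by
      rw [Real.rpow_neg (by positivity), ← Real.sqrt_eq_rpow, Real.sqrt_sq hr.le]
    simp only [Function.comp]
    rw [e, Real.div_rpow (hq r hr.le).le (by positivity), e2]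
    field_simp
  have hint : IntegrableOn
      (fun r : ℝ => r * (r ^ 2 + 2 * r * c + 1) ^ (-((2 + 1) / 2) : ℝ)) (Set.Ioi 0) := by
    refine integrableOn_Ioi_deriv_of_nonneg' hderiv (fun r hr => ?_) hlim
    exact mul_nonneg (le_of_lt hr) (Real.rpow_nonneg (hq r (Set.Ioi_subset_Ici_self hr)).le _)
  rw [integral_Ioi_of_hasDerivAt_of_tendsto' hderiv hint hlim]
  have h1 : 1 + c ≠ 0 := by positivity
  norm_num
  field_simp
  ring

lemma integral_one_div_one_add_cos {θ : ℝ} (hθ : θ ∈ Set.Ioo 0 (Real.pi / 2)) :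
    ∫ t in Set.Ioo (0 : ℝ) θ, 1 / (1 + Real.cos t) = Real.sin θ / (1 + Real.cos θ) := by
  have hpos : ∀ t ∈ Set.uIcc 0 θ, 1 + Real.cos t ≠ 0 := by
    intro t ht
    rw [Set.uIcc_of_le hθ.1.le] at ht
    have := Real.cos_nonneg_of_mem_Icc (x := t)
      ⟨by linarith [ht.1, Real.pi_pos], by linarith [ht.2, hθ.2]⟩
    positivity
  rw [← integral_Ioc_eq_integral_Ioo, ← intervalIntegral.integral_of_le hθ.1.le,
    intervalIntegral.integral_eq_sub_of_hasDerivAt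
      (f := fun t => Real.sin t / (1 + Real.cos t))]
  · simp
  · intro t ht
    have h := (Real.hasDerivAt_sin t).div ((Real.hasDerivAt_cos t).const_add 1) (hpos t ht)
    refine h.congr_deriv ?_
    have := hpos t ht
    field_simp
    nlinarith [Real.sin_sq_add_cos_sq t]
  · apply ContinuousOn.intervalIntegrable
    exact continuousOn_const.div (by fun_prop) hpos

/-- for every `θ ∈ (0, π/2)`,
`lim_{s→1⁻} ∫₀^θ ∫₀^∞ r (r² + 2r cos t + 1)^{−(2+s)/2} dr dt = sin θ / (1 + cos θ)`. -/
theorem stmt8 (θ : ℝ) (hθ : θ ∈ Set.Ioo 0 (Real.pi / 2)) :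
    Tendsto (fun s : ℝ =>
        ∫ t in Set.Ioo (0 : ℝ) θ, ∫ r in Set.Ioi (0 : ℝ),
          r * (r ^ 2 + 2 * r * Real.cos t + 1) ^ (-((2 + s) / 2)))
      (𝓝[<] (1 : ℝ)) (nhds (Real.sin θ / (1 + Real.cos θ))) := by
  have hcos : ∀ t ∈ Set.Ioo (0 : ℝ) θ, 0 ≤ Real.cos t := fun t ht =>
    Real.cos_nonneg_of_mem_Icc ⟨by linarith [ht.1, Real.pi_pos], by linarith [ht.2, hθ.2]⟩
  rw [← integral_one_div_one_add_cos hθ]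
  refine tendsto_integral_filter_of_dominated_convergence
    (fun _ => ∫ r in Set.Ioi (0 : ℝ), (1 + r ^ 2) ^ (-(3 / 4) : ℝ)) ?_ ?_
    (integrable_const _) ?_
  · refine Eventually.of_forall fun s => StronglyMeasurable.aestronglyMeasurable ?_
    refine StronglyMeasurable.integral_prod_right (f := fun t r : ℝ =>
      r * (r ^ 2 + 2 * r * Real.cos t + 1) ^ (-((2 + s) / 2))) ?_
    apply Measurable.stronglyMeasurable
    simp only [Function.uncurry_def]
    fun_prop
  · filter_upwards [Ioo_mem_nhdsLT (show (1 / 2 : ℝ) < 1 by norm_num)] with s hs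
    filter_upwards [ae_restrict_mem measurableSet_Ioo] with t ht
    refine norm_integral_le_of_norm_le integrable_one_add_sq_rpow.integrableOn ?_
    filter_upwards [ae_restrict_mem measurableSet_Ioi] with r hr
    exact norm_mul_quadratic_rpow_le (le_of_lt hr) (hcos t ht) hs.1.le
  · filter_upwards [ae_restrict_mem measurableSet_Ioo] with t ht
    have hlt : Real.cos t < 1 := by
      rw [← Real.cos_zero]
      exact Real.cos_lt_cos_of_nonneg_of_le_pi le_rfl
        (by linarith [ht.2, hθ.2, Real.pi_pos]) ht.1
    rw [← integral_mul_quadratic_rpow (hcos t ht) hlt]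
    exact tendsto_integral_mul_quadratic_rpow (hcos t ht)
end
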